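/- arXiv:1011.1403 — 2 statements merged into one kernel-verified Lean document; each statement's English description precedes it below -/
import Mathlib

section
/- There exist x, y ∈ ℤ_{-τ} such that (-τ)·(x + y) ∉ ℤ_{-τ}; together with the bound τ²·(x+y) ∈ ℤ_{-τ} for all x, y ∈ ℤ_{-τ}, this shows L_⊕(-τ) = 2. (One may take x = y = 1 + (-τ) + (-τ)² + (-τ)³.) -/
/-- The Ito–Sadahiro transformation `T_{-β}` on `[l_β, r_β)`, where
`l_β = -β/(β+1)` and `r_β = 1/(β+1)`. -/
noncomputable def negT (β : ℝ) (x : ℝ) : ℝ :=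
  -β * x - (⌊-β * x - (-β / (β + 1))⌋ : ℝ)

/-- `Fin(-β)`: reals `x` such that `(-β)^k * x ∈ (l_β, r_β)` for some `k : ℤ`
and some iterate of `T_{-β}` sends it to `0`. -/
def negFin (β : ℝ) (x : ℝ) : Prop :=
  ∃ (k : ℤ) (n : ℕ), ((-β) ^ k * x ∈ Set.Ioo (-β / (β + 1)) (1 / (β + 1))) ∧
    (negT β)^[n] ((-β) ^ k * x) = 0

/-- The set `ℤ_{-β}` of `(-β)`-integers. -/
def negInt (β : ℝ) (x : ℝ) : Prop :=
  x = 0 ∨ ∃ (N : ℕ) (y : ℝ), y ∈ Set.Ioo (-β / (β + 1)) (1 / (β + 1)) ∧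
    x = (-β) ^ (N + 1) * y ∧ (negT β)^[N + 1] y = 0

/-- The `(-β)`-digit `d_{i+1}(y)` of `y ∈ [l_β, r_β)` (indices shifted so that
`negDigit β y i` is the digit `d_{i+1}(y)`). -/
noncomputable def negDigit (β : ℝ) (y : ℝ) (i : ℕ) : ℤ :=
  ⌊-β * ((negT β)^[i] y) - (-β / (β + 1))⌋

/-- The golden ratio `τ = (1+√5)/2`. -/
noncomputable def tau : ℝ := (1 + Real.sqrt 5) / 2

/-- The Rényi transformation `T_β` on `[0,1)`. -/
noncomputable def renyiT (β : ℝ) (x : ℝ) : ℝ := β * x - (⌊β * x⌋ : ℝ)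

/-- The set `ℤ_β` of (nonnegative) `β`-integers. -/
def posInt (β : ℝ) (x : ℝ) : Prop :=
  x = 0 ∨ ∃ N : ℕ, (β ^ (-(N + 1 : ℤ)) * x ∈ Set.Ico (0 : ℝ) 1) ∧
    (renyiT β)^[N + 1] (β ^ (-(N + 1 : ℤ)) * x) = 0

theorem tau_sq : tau ^ 2 = tau + 1 := by
  have h : Real.sqrt 5 ^ 2 = 5 := Real.sq_sqrt (by norm_num)
  unfold tau
  linear_combination h / 4

theorem tau_gt : (1.618 : ℝ) < tau := by
  have h : (2.236 : ℝ) < Real.sqrt 5 := Real.lt_sqrt_of_sq_lt (by norm_num)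
  unfold tau
  linarith

theorem tau_lt : tau < (1.6181 : ℝ) := by
  have h : Real.sqrt 5 < (2.2362 : ℝ) := (Real.sqrt_lt' (by norm_num)).2 (by norm_num)
  unfold tau
  linarith

theorem neg_tau_ne_zero : -tau ≠ 0 := by
  have := tau_gt
  intro h
  linarith

theorem neg_tau_div_tau_add_one : -tau / (tau + 1) = 1 - tau := by
  have h := tau_gt
  rw [div_eq_iff (by linarith)]
  linear_combination tau_sq

theorem one_div_tau_add_one : 1 / (tau + 1) = 2 - tau := by
  have h := tau_gt
  rw [div_eq_iff (by linarith)]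
  linear_combination tau_sq

/-- `T_{-τ}(y)` is the representative of `-τy` modulo `1` in `[1 - τ, 2 - τ)`. -/
theorem negT_tau_eq {y v : ℝ} (m : ℤ) (hv : v = -tau * y - m) (h₁ : 1 - tau ≤ v)
    (h₂ : v < 2 - tau) : negT tau y = v := by
  have hm : ⌊-tau * y - (-tau / (tau + 1))⌋ = m := by
    rw [neg_tau_div_tau_add_one, Int.floor_eq_iff]
    constructor <;> linarith
  rw [negT, hm, hv]

theorem negT_tau_add_mul {a b c : ℝ} (m : ℤ) (hc : c = -b - m) (h₁ : 1 - tau ≤ c + (-a - b) * tau)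
    (h₂ : c + (-a - b) * tau < 2 - tau) : negT tau (a + b * tau) = c + (-a - b) * tau :=
  negT_tau_eq m (by linear_combination hc + b * tau_sq) h₁ h₂

theorem negT_tau_div {w : ℝ} (hw : w ∈ Set.Ioo (1 - tau) (2 - tau)) :
    negT tau (w / -tau) = w :=
  negT_tau_eq 0 (by rw [Int.cast_zero, sub_zero, mul_div_cancel₀ _ neg_tau_ne_zero])
    hw.1.le hw.2

theorem div_neg_tau_mem {w : ℝ} (hw : w ∈ Set.Ioo (1 - tau) (2 - tau)) :
    w / -tau ∈ Set.Ioo (1 - tau) (2 - tau) := by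
  have h := tau_gt
  have hs := tau_sq
  obtain ⟨h₁, h₂⟩ := hw
  have e : w / -tau * tau = -w := by
    rw [div_mul_eq_mul_div, div_eq_iff neg_tau_ne_zero]
    ring
  constructor
  · by_contra! hc
    nlinarith
  · by_contra! hc
    nlinarith

theorem div_neg_tau_pow_mem {w : ℝ} (hw : w ∈ Set.Ioo (1 - tau) (2 - tau)) (k : ℕ) :
    w / (-tau) ^ k ∈ Set.Ioo (1 - tau) (2 - tau) := by
  induction k with
  | zero => simpa using hw
  | succ k ih =>
    rw [pow_succ, ← div_div]
    exact div_neg_tau_mem ih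

theorem negT_tau_iterate_div_pow {w : ℝ} (hw : w ∈ Set.Ioo (1 - tau) (2 - tau)) (k : ℕ) :
    (negT tau)^[k] (w / (-tau) ^ k) = w := by
  induction k with
  | zero => simp
  | succ k ih =>
    rw [Function.iterate_succ_apply, pow_succ, ← div_div,
      negT_tau_div (div_neg_tau_pow_mem hw k), ih]

theorem tau_pow_three : tau ^ 3 = 2 * tau + 1 := by
  linear_combination (tau + 1) * tau_sq

theorem tau_pow_four : tau ^ 4 = 3 * tau + 2 := by
  linear_combination tau * tau_pow_three + 2 * tau_sq

theorem tau_pow_five : tau ^ 5 = 5 * tau + 3 := by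
  linear_combination tau * tau_pow_four + 3 * tau_sq

theorem tau_pow_six : tau ^ 6 = 8 * tau + 5 := by
  linear_combination tau * tau_pow_five + 5 * tau_sq

theorem tau_pow_seven : tau ^ 7 = 13 * tau + 8 := by
  linear_combination tau * tau_pow_six + 8 * tau_sq

theorem negInt_one_sub_two_mul_tau : negInt tau (1 - 2 * tau) := by
  have h₁ := tau_gt
  have h₂ := tau_lt
  refine Or.inr ⟨3, 11 + -7 * tau, ?_, ?_, ?_⟩
  · rw [neg_tau_div_tau_add_one, one_div_tau_add_one]
    constructor <;> linarith
  · linear_combination -(11 - 7 * tau) * tau_pow_four + 21 * tau_sq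
  · simp only [Function.iterate_succ_apply, Function.iterate_zero_apply]
    rw [negT_tau_add_mul (c := 6) 1, negT_tau_add_mul (c := 3) 1, negT_tau_add_mul (c := 1) 1,
      negT_tau_add_mul (c := 0) 1] <;> norm_num <;> linarith

theorem negT_tau_iterate_seven : (negT tau)^[7] (58 + -36 * tau) = 1 - tau := by
  have h₁ := tau_gt
  have h₂ := tau_lt
  simp only [Function.iterate_succ_apply, Function.iterate_zero_apply]
  rw [negT_tau_add_mul (c := 35) 1, negT_tau_add_mul (c := 21) 1, negT_tau_add_mul (c := 13) 0,
    negT_tau_add_mul (c := 8) 0, negT_tau_add_mul (c := 5) 0, negT_tau_add_mul (c := 3) 0,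
    negT_tau_add_mul (c := 1) 1] <;> norm_num <;> linarith

theorem not_negInt_four_add_two_mul_tau : ¬ negInt tau (4 + 2 * tau) := by
  have h₁ := tau_gt
  have h₂ := tau_lt
  have hs := tau_sq
  rintro (h | ⟨N, y, hy, hz, hT⟩)
  · linarith
  rw [neg_tau_div_tau_add_one, one_div_tau_add_one] at hy
  rcases lt_or_ge N 6 with hN | hN
  · obtain ⟨hl, hr⟩ := hy
    have e₃ := tau_pow_three
    have e₄ := tau_pow_four
    have e₅ := tau_pow_five
    have e₆ := tau_pow_six
    interval_cases N <;> ring_nf at hz <;>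
      (try simp only [e₃, e₄, e₅, e₆, hs] at hz) <;> nlinarith
  · obtain ⟨k, rfl⟩ := Nat.exists_eq_add_of_le hN
    have hw : (58 + -36 * tau) ∈ Set.Ioo (1 - tau) (2 - tau) := by
      constructor <;> linarith
    have hy' : y = (58 + -36 * tau) / (-tau) ^ k := by
      rw [eq_div_iff (pow_ne_zero _ neg_tau_ne_zero)]
      apply mul_left_cancel₀ (pow_ne_zero 7 neg_tau_ne_zero)
      rw [show 6 + k + 1 = 7 + k by ring, pow_add] at hz
      linear_combination -hz + (58 - 36 * tau) * tau_pow_seven - 468 * tau_sq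
    rw [hy', show 6 + k + 1 = 7 + k by ring, Function.iterate_add_apply,
      negT_tau_iterate_div_pow hw, negT_tau_iterate_seven] at hT
    linarith

/-- There exist `x, y ∈ ℤ_{-τ}` with `(-τ)(x + y) ∉ ℤ_{-τ}`, i.e. `L_⊕(-τ) ≥ 2`. -/
theorem L_oplus_neg_tau_ge_two :
    ∃ x y : ℝ, negInt tau x ∧ negInt tau y ∧ ¬ negInt tau ((-tau) * (x + y)) := by
  refine ⟨_, _, negInt_one_sub_two_mul_tau, negInt_one_sub_two_mul_tau, ?_⟩
  rw [show -tau * (1 - 2 * tau + (1 - 2 * tau)) = 4 + 2 * tau by linear_combination 4 * tau_sq]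
  exact not_negInt_four_add_two_mul_tau
end

section
/- Let m, n be integers with m > n ≥ 1 and let β > 1 be the positive root of x² - mx - n. Let N ∈ ℤ and let (x_i)_{i∈ℤ} be integers with 0 ≤ x_i ≤ m for all i, x_i = 0 for all i > N, and x_i ≠ 0 for only finitely many i. Set y = Σ_{j≥1} x_{N+1-j}·(-β)^{-j}. Then the following are equivalent: (a) y ∈ (l_β, r_β) and d_j(y) = x_{N+1-j} for every j ≥ 1 (i.e., x_N x_{N-1} x_{N-2} ⋯ is the (-β)-expansion digit string); (b) there are no index i and integer k ≥ 0 such that either [x_i = m, the 2k entries x_{i-1}, …, x_{i-2k} all equal m-n, and x_{i-2k-1} ≤ m-n-1] or [x_i = m, the 2k+1 entries x_{i-1}, …, x_{i-2k-1} all equal m-n, and x_{i-2k-2} ≥ m-n+1]. -/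
/-- The value `Σ_{j≥0} x_{a-j} (-β)^{-(j+1)}` of the digit string `x_a x_{a-1} ⋯`. -/
noncomputable def negTail (β : ℝ) (x : ℤ → ℤ) (a : ℤ) : ℝ :=
  ∑' j : ℕ, (x (a - (j : ℤ)) : ℝ) * (-β) ^ (-(j + 1) : ℤ)

theorem negTail_rec {β : ℝ} (hβ : 0 < β) {x : ℤ → ℤ} (hfin : {i : ℤ | x i ≠ 0}.Finite) (a : ℤ) :
    -β * negTail β x a = x a + negTail β x (a - 1) := by
  have hβ' : -β ≠ 0 := by linarith
  have hsum : Summable fun j : ℕ => (x (a - (j : ℤ)) : ℝ) * (-β) ^ (-(j + 1) : ℤ) := by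
    apply summable_of_hasFiniteSupport
    refine (hfin.preimage (f := fun j : ℕ => a - (j : ℤ)) ?_).subset ?_
    · intro i _ j _ h
      simp only at h
      omega
    · intro j hj h
      exact hj (by simp only [h, Int.cast_zero, zero_mul])
  unfold negTail
  rw [hsum.tsum_eq_zero_add, mul_add, ← tsum_mul_left]
  congr 1
  · simp only [Nat.cast_zero, sub_zero, zero_add, zpow_neg, zpow_one]
    field_simp
  · refine tsum_congr fun j => ?_
    have e : (-β) ^ (-((j : ℤ) + 1)) = -β * (-β) ^ (-(((j + 1 : ℕ) : ℤ) + 1)) := by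
      rw [← zpow_one_add₀ hβ']
      congr 1
    have i : a - ((j + 1 : ℕ) : ℤ) = a - 1 - j := by
      push_cast
      ring
    rw [e, i]
    ring

theorem negTail_eq_zero {β : ℝ} {x : ℤ → ℤ} {a : ℤ} (h : ∀ i ≤ a, x i = 0) :
    negTail β x a = 0 := by
  unfold negTail
  rw [← tsum_zero (β := ℕ)]
  refine tsum_congr fun j => ?_
  rw [h _ (by omega), Int.cast_zero, zero_mul]

theorem one_div_add_one_eq {β : ℝ} (hβ : 0 < β) : 1 / (β + 1) = -β / (β + 1) + 1 := by
  field_simp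
  ring

theorem negT_mem_Ico {β : ℝ} (hβ : 0 < β) (y : ℝ) :
    negT β y ∈ Set.Ico (-β / (β + 1)) (1 / (β + 1)) := by
  rw [one_div_add_one_eq hβ]
  unfold negT
  constructor
  · linarith [Int.floor_le (-β * y - (-β / (β + 1)))]
  · linarith [Int.lt_floor_add_one (-β * y - (-β / (β + 1)))]

/-- A string satisfying the tail recursion is the expansion of its value exactly when
all its tails have values in `[l_β, r_β)`. -/
theorem negDigit_eq_iff {β : ℝ} (hβ : 0 < β) {x : ℤ → ℤ} {S : ℤ → ℝ}
    (hS : ∀ a, -β * S a = x a + S (a - 1)) {N : ℤ}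
    (hN : S N ∈ Set.Ico (-β / (β + 1)) (1 / (β + 1))) :
    (∀ j : ℕ, negDigit β (S N) j = x (N - j)) ↔
      ∀ j : ℕ, S (N - j) ∈ Set.Ico (-β / (β + 1)) (1 / (β + 1)) := by
  have step (j : ℕ) : N - ((j + 1 : ℕ) : ℤ) = N - j - 1 := by
    push_cast
    ring
  constructor
  · intro h
    have key : ∀ j : ℕ, (negT β)^[j] (S N) = S (N - j) := by
      intro j
      induction j with
      | zero => simp
      | succ j ih =>
        have hj := h j
        unfold negDigit at hj
        rw [ih] at hj
        rw [Function.iterate_succ_apply', ih, negT, hj, hS, step]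
        ring
    intro j
    cases j with
    | zero => simpa using hN
    | succ j =>
      rw [← key, Function.iterate_succ_apply']
      exact negT_mem_Ico hβ _
  · intro h
    have dig (j : ℕ) : ⌊-β * S (N - j) - (-β / (β + 1))⌋ = x (N - j) := by
      have hj := h (j + 1)
      rw [step, one_div_add_one_eq hβ] at hj
      rw [hS, Int.floor_eq_iff]
      constructor <;> linarith [hj.1, hj.2]
    have key : ∀ j : ℕ, (negT β)^[j] (S N) = S (N - j) := by
      intro j
      induction j with
      | zero => simp
      | succ j ih =>
        rw [Function.iterate_succ_apply', ih, negT, dig, hS, step]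
        ring
    intro j
    rw [negDigit, key, dig]

/-- Reading a digit `c` multiplies the distance to the value `-c/(β+1)` of `c c c ⋯` by `-β`. -/
theorem sub_eq_mul_of_run {β : ℝ} (hβ : 0 < β) {x : ℤ → ℤ} {S : ℤ → ℝ}
    (hS : ∀ a, -β * S a = x a + S (a - 1)) {c b : ℤ} (T : ℕ)
    (h : ∀ t < T, x (b - t) = c) :
    S (b - T) - -c / (β + 1) = (-β) ^ T * (S b - -c / (β + 1)) := by
  induction T with
  | zero => simp
  | succ T ih =>
    have e : b - ((T + 1 : ℕ) : ℤ) = b - T - 1 := by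
      push_cast
      ring
    have h1 := hS (b - T)
    rw [h T (by omega)] at h1
    have h2 : (c : ℝ) + -c / (β + 1) = -β * (-c / (β + 1)) := by
      field_simp
      ring
    rw [e, pow_succ', mul_assoc, ← ih fun t ht => h t (by omega)]
    linarith

section Comparison

variable {β : ℝ} {x : ℤ → ℤ} {S : ℤ → ℝ} {c b : ℤ}

theorem lt_value_of_digit_lt (hβ : 0 < β) (hS : ∀ a, -β * S a = x a + S (a - 1))
    (hc : (c : ℝ) < β) (hb : S (b - 1) < 1 / (β + 1)) (hx : x b < c) :
    -c / (β + 1) < S b := by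
  have h0 : (x b : ℝ) + 1 ≤ c := by exact_mod_cast hx
  have h1 := hS b
  have h2 : (c : ℝ) - 1 + 1 / (β + 1) < -β * (-c / (β + 1)) := by
    field_simp
    linarith
  nlinarith

theorem value_lt_of_lt_digit (hβ : 0 < β) (hS : ∀ a, -β * S a = x a + S (a - 1))
    (hc : (-1 : ℝ) < c) (hb : -β / (β + 1) ≤ S (b - 1)) (hx : c < x b) :
    S b < -c / (β + 1) := by
  have h0 : (c : ℝ) + 1 ≤ x b := by exact_mod_cast hx
  have h1 := hS b
  have h2 : -β * (-c / (β + 1)) < (c : ℝ) + 1 + -β / (β + 1) := by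
    field_simp
    linarith
  nlinarith

variable {T : ℕ}

theorem value_lt_tail_of_run (hβ : 0 < β) (hS : ∀ a, -β * S a = x a + S (a - 1))
    (hc : (-1 : ℝ) < c) (hc' : (c : ℝ) < β) (hrun : ∀ t < T, x (b - t) = c)
    (hb : S (b - T - 1) ∈ Set.Ico (-β / (β + 1)) (1 / (β + 1)))
    (h : (Even T ∧ x (b - T) < c) ∨ (Odd T ∧ c < x (b - T))) :
    -c / (β + 1) < S b := by
  have key := sub_eq_mul_of_run hβ hS T hrun
  rcases h with ⟨hT, hx⟩ | ⟨hT, hx⟩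
  · have h1 := lt_value_of_digit_lt hβ hS hc' hb.2 hx
    have h2 : 0 < (-β) ^ T := hT.pow_pos (by linarith)
    have := pos_of_mul_pos_right (key ▸ sub_pos.2 h1) h2.le
    linarith
  · have h1 := value_lt_of_lt_digit hβ hS hc hb.1 hx
    have h2 : (-β) ^ T < 0 := hT.pow_neg (by linarith)
    by_contra! h3
    nlinarith [mul_nonneg_of_nonpos_of_nonpos h2.le (sub_nonpos.2 h3)]

theorem tail_lt_value_of_run (hβ : 0 < β) (hS : ∀ a, -β * S a = x a + S (a - 1))
    (hc : (-1 : ℝ) < c) (hc' : (c : ℝ) < β) (hrun : ∀ t < T, x (b - t) = c)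
    (hb : S (b - T - 1) ∈ Set.Ico (-β / (β + 1)) (1 / (β + 1)))
    (h : (Even T ∧ c < x (b - T)) ∨ (Odd T ∧ x (b - T) < c)) :
    S b < -c / (β + 1) := by
  have key := sub_eq_mul_of_run hβ hS T hrun
  by_contra! h3
  rcases h with ⟨hT, hx⟩ | ⟨hT, hx⟩
  · have h1 := value_lt_of_lt_digit hβ hS hc hb.1 hx
    have h2 : 0 < (-β) ^ T := hT.pow_pos (by linarith)
    nlinarith [mul_nonneg h2.le (sub_nonneg.2 h3)]
  · have h1 := lt_value_of_digit_lt hβ hS hc' hb.2 hx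
    have h2 : (-β) ^ T < 0 := hT.pow_neg (by linarith)
    nlinarith [mul_nonpos_of_nonpos_of_nonneg h2.le (sub_nonneg.2 h3)]

end Comparison

/-- admissibility criterion for `(-β)`-expansions, case `m > n ≥ 1`,
`β > 1` the positive root of `x² - mx - n`.  Here `y = Σ_{j≥1} x_{N+1-j} (-β)^{-j}`
and `negDigit β y j = d_{j+1}(y)`, so condition (a) reads
`y ∈ (l_β, r_β)` and `d_{j+1}(y) = x_{N-j}` for all `j ∈ ℕ`. -/
theorem admissibility_criterion_m_gt_n
    (m n : ℤ) (hn : 1 ≤ n) (hmn : n < m) (β : ℝ) (hβ : 1 < β)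
    (hroot : β ^ 2 - (m : ℝ) * β - (n : ℝ) = 0)
    (N : ℤ) (x : ℤ → ℤ)
    (hbound : ∀ i : ℤ, 0 ≤ x i ∧ x i ≤ m)
    (htop : ∀ i : ℤ, N < i → x i = 0)
    (hfin : {i : ℤ | x i ≠ 0}.Finite)
    (y : ℝ) (hy : y = ∑' j : ℕ, (x (N - (j : ℤ)) : ℝ) * (-β) ^ (-(j + 1) : ℤ)) :
    (y ∈ Set.Ioo (-β / (β + 1)) (1 / (β + 1)) ∧
        ∀ j : ℕ, negDigit β y j = x (N - (j : ℤ)))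
      ↔
    ¬ ∃ (i k : ℤ), 0 ≤ k ∧
        ((x i = m ∧ (∀ t : ℤ, 1 ≤ t → t ≤ 2 * k → x (i - t) = m - n) ∧
            x (i - (2 * k + 1)) ≤ m - n - 1) ∨
         (x i = m ∧ (∀ t : ℤ, 1 ≤ t → t ≤ 2 * k + 1 → x (i - t) = m - n) ∧
            m - n + 1 ≤ x (i - (2 * k + 2)))) := by
  have hβ0 : 0 < β := by linarith
  have hS := negTail_rec hβ0 hfin
  have hyS : y = negTail β x N := hy
  set S := negTail β x with hSdef
  have hnR : (1 : ℝ) ≤ n := by exact_mod_cast hn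
  have hmnR : (n : ℝ) + 1 ≤ m := by exact_mod_cast hmn
  have hβm : (m : ℝ) < β := by nlinarith
  have hc : (-1 : ℝ) < (m - n : ℤ) := by
    push_cast
    linarith
  have hc' : ((m - n : ℤ) : ℝ) < β := by
    push_cast
    linarith
  have hl : -β * (-β / (β + 1)) = m + -((m - n : ℤ) : ℝ) / (β + 1) := by
    push_cast
    field_simp
    linarith
  have hr : -β * (1 / (β + 1)) = -β / (β + 1) := by ring
  have hlr := one_div_add_one_eq hβ0
  rw [hyS]
  constructor
  · rintro ⟨hN, hdig⟩ ⟨i, k, hk, hforb⟩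
    have hmem := (negDigit_eq_iff hβ0 hS (Set.Ioo_subset_Ico_self hN)).1 hdig
    have hxi : x i = m := by tauto
    have hiN : i ≤ N := by
      by_contra! h
      have := htop i h
      omega
    have hall : ∀ a ≤ N, S a ∈ Set.Ico (-β / (β + 1)) (1 / (β + 1)) := by
      intro a ha
      have := hmem (N - a).toNat
      rwa [show N - ((N - a).toNat : ℤ) = a by omega] at this
    lift k to ℕ using hk
    have hgt : -((m - n : ℤ) : ℝ) / (β + 1) < S (i - 1) := by
      rcases hforb with ⟨-, hrun, hx⟩ | ⟨-, hrun, hx⟩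
      · refine value_lt_tail_of_run (T := 2 * k) hβ0 hS hc hc' (fun t ht => ?_)
          (hall _ (by omega)) (Or.inl ⟨even_two_mul k, ?_⟩)
        · rw [← hrun (t + 1) (by omega) (by omega)]
          congr 1
          ring
        · rw [show i - 1 - ((2 * k : ℕ) : ℤ) = i - (2 * k + 1) by push_cast; ring]
          omega
      · refine value_lt_tail_of_run (T := 2 * k + 1) hβ0 hS hc hc' (fun t ht => ?_)
          (hall _ (by omega)) (Or.inr ⟨odd_two_mul_add_one k, ?_⟩)
        · rw [← hrun (t + 1) (by omega) (by omega)]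
          congr 1
          ring
        · rw [show i - 1 - ((2 * k + 1 : ℕ) : ℤ) = i - (2 * k + 2) by push_cast; ring]
          omega
    have h1 := hS i
    rw [hxi] at h1
    nlinarith [(hall i hiN).1]
  · intro hno
    obtain ⟨L, hL⟩ := hfin.bddBelow
    have hzero : ∀ i < L, x i = 0 := by
      intro i hi
      by_contra h
      exact absurd (hL h) (not_le.2 hi)
    have hall : ∀ k : ℕ, ∀ a < L + k, S a ∈ Set.Ioo (-β / (β + 1)) (1 / (β + 1)) := by
      intro k
      induction k with
      | zero =>
        intro a ha
        have h0 : S a = 0 := negTail_eq_zero fun i hi => hzero i (by omega)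
        rw [h0]
        exact ⟨div_neg_of_neg_of_pos (by linarith) (by linarith), by positivity⟩
      | succ k ih =>
        intro a ha
        have h1 := hS a
        have hpred := ih (a - 1) (by omega)
        have hx0 : (0 : ℝ) ≤ x a := by exact_mod_cast (hbound a).1
        refine ⟨?_, by nlinarith [hpred.1]⟩
        rcases (hbound a).2.lt_or_eq with hlt | heq
        · have h2 : (x a : ℝ) + 1 ≤ m := by exact_mod_cast hlt
          have h3 : (m : ℝ) - 1 + 1 / (β + 1) < -β * (-β / (β + 1)) := by
            rw [hl]
            push_cast
            field_simp
            linarith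
          nlinarith [hpred.2]
        · have hex : ∃ T : ℕ, x (a - 1 - T) ≠ m - n := by
            refine ⟨(a - L).toNat, ?_⟩
            rw [hzero _ (by omega)]
            omega
          classical
          obtain ⟨T, hT, hmin⟩ : ∃ T : ℕ, x (a - 1 - T) ≠ m - n ∧
              ∀ t < T, x (a - 1 - t) = m - n :=
            ⟨Nat.find hex, Nat.find_spec hex, fun t ht => not_not.1 (Nat.find_min hex ht)⟩
          have hrun : ∀ t : ℤ, 1 ≤ t → t ≤ T → x (a - t) = m - n := by
            intro t ht htT
            rw [← hmin (t - 1).toNat (by omega)]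
            congr 1
            omega
          have hlt : S (a - 1) < -((m - n : ℤ) : ℝ) / (β + 1) := by
            refine tail_lt_value_of_run hβ0 hS hc hc' hmin
              (Set.Ioo_subset_Ico_self (ih _ (by omega))) ?_
            rcases Nat.even_or_odd' T with ⟨q, rfl | rfl⟩
            · refine Or.inl ⟨even_two_mul q, ?_⟩
              by_contra! hle
              refine hno ⟨a, q, by omega, Or.inl ⟨heq, fun t h h' => hrun t h (by omega), ?_⟩⟩
              rw [show a - (2 * (q : ℤ) + 1) = a - 1 - (2 * q : ℕ) by push_cast; ring]
              omega
            · refine Or.inr ⟨odd_two_mul_add_one q, ?_⟩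
              by_contra! hle
              refine hno ⟨a, q, by omega, Or.inr ⟨heq, fun t h h' => hrun t h (by omega), ?_⟩⟩
              rw [show a - (2 * (q : ℤ) + 2) = a - 1 - (2 * q + 1 : ℕ) by push_cast; ring]
              omega
          rw [heq] at h1
          nlinarith
    have hIoo (a : ℤ) : S a ∈ Set.Ioo (-β / (β + 1)) (1 / (β + 1)) :=
      hall (a - L + 1).toNat a (by omega)
    exact ⟨hIoo N, (negDigit_eq_iff hβ0 hS (Set.Ioo_subset_Ico_self (hIoo N))).2
      fun j => Set.Ioo_subset_Ico_self (hIoo _)⟩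
end
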